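/- arXiv:2208.06500 — 2 statements merged into one kernel-verified Lean document; each statement's English description precedes it below -/
import Mathlib

section
/- Under the WSFv3 model with no change points, for every t₀ ∈ ℝ and every ξ ≥ 0, the STFT with the modified window u ↦ u·h(u) satisfies: | −i2π V_x^{(u·h)}(t₀, ξ) − (1/2) Σ_{l≥1} B_l(t₀) e^{i2πφ_l(t₀)} ĥ'(ξ − φ_l'(t₀)) | ≤ ε·[ (2π/ℓ)( φ_ℓ'(t₀) m₂ + M m₃/2 ) Σ_{l≥1} c(l) + (2π²/ℓ)( φ_ℓ'(t₀) m₃ + M m₄/3 ) Σ_{l≥1} l·B_l(t₀) ]. (Equivalently, this is the second estimate of Lemma 2 for ∂_ξ V_x^{(h)}(t₀, ξ), since ∂_ξ V_x^{(h)} = −i2π V_x^{(u·h)}.) -/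
open Real MeasureTheory
open scoped FourierTransform

/-- Short-time Fourier transform of `x` with window `g`:
`V_x^{(g)}(t, ξ) = ∫ x(u) g(u − t) e^{−i2πξ(u−t)} du`. -/
noncomputable def STFT (g : ℝ → ℝ) (x : ℝ → ℝ) (t ξ : ℝ) : ℂ :=
  ∫ u : ℝ, ((x u * g (u - t) : ℝ) : ℂ) *
    Complex.exp (-(2 * π * Complex.I * ξ * (u - t)))

lemma aux_mv (f f' F F' : ℝ → ℝ) (hf : ∀ s, HasDerivAt f (f' s) s)
    (hF : ∀ s, HasDerivAt F (F' s) s) (f0 : f 0 = 0) (F0 : F 0 = 0)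
    (hb : ∀ s, |f' s| ≤ F' |s|) (s : ℝ) : |f s| ≤ F |s| := by
  have key : ∀ (g g' : ℝ → ℝ), (∀ s, HasDerivAt g (g' s) s) → g 0 = 0 →
      (∀ s, |g' s| ≤ F' |s|) → ∀ s, 0 ≤ s → |g s| ≤ F s := by
    intro g g' hg g0 hgb s hs
    have := image_norm_le_of_norm_deriv_right_le_deriv_boundary (a := 0) (b := s) (f := g)
      (f' := g') (B := F) (B' := F')
      (fun x _ => (hg x).continuousAt.continuousWithinAt)
      (fun x _ => (hg x).hasDerivWithinAt) (by simp [g0, F0]) hF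
      (fun x hx => by
        have := hgb x
        rwa [abs_of_nonneg hx.1] at this)
      (x := s) ⟨hs, le_rfl⟩
    simpa using this
  rcases le_total 0 s with hs | hs
  · rw [abs_of_nonneg hs]
    exact key f f' hf f0 hb s hs
  · rw [abs_of_nonpos hs]
    have := key (fun u => f (-u)) (fun u => - f' (-u))
      (fun u => by
        have := (hf (-u)).scomp u (hasDerivAt_neg u)
        simpa using! this)
      (by simpa using f0) (fun u => by simpa using hb (-u)) (-s) (by linarith)
    simpa using this

lemma aux_first (f : ℝ → ℝ) (hf : ContDiff ℝ 1 f) (t a b : ℝ)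
    (hb : ∀ s, |deriv f (t + s)| ≤ a + b * |s|) (s : ℝ) :
    |f (t + s) - f t| ≤ a * |s| + b * |s| ^ 2 / 2 := by
  have hd : ∀ s, HasDerivAt f (deriv f s) s := fun s =>
    ((hf.differentiable (by norm_num)) s).hasDerivAt
  refine aux_mv (fun s => f (t + s) - f t) (fun s => deriv f (t + s))
    (fun s => a * s + b * s ^ 2 / 2) (fun s => a + b * s) ?_ ?_ (by simp) (by simp) hb s
  · intro s
    exact (HasDerivAt.comp_const_add t s (hd (t + s))).sub_const _
  · intro s
    have := ((hasDerivAt_id s).const_mul a).add (((hasDerivAt_pow 2 s).const_mul b).div_const 2)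
    convert! this using 1
    simp
    ring

lemma aux_second (f : ℝ → ℝ) (hf : ContDiff ℝ 2 f) (t a b : ℝ)
    (hb : ∀ s, |deriv (deriv f) (t + s)| ≤ a + b * |s|) (s : ℝ) :
    |f (t + s) - f t - deriv f t * s| ≤ a * |s| ^ 2 / 2 + b * |s| ^ 3 / 6 := by
  have hd : ∀ s, HasDerivAt f (deriv f s) s := fun s =>
    ((hf.differentiable (by norm_num)) s).hasDerivAt
  have hf' : ContDiff ℝ 1 (deriv f) := by
    have : ContDiff ℝ (1 + 1) f := by simpa [one_add_one_eq_two] using hf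
    exact (contDiff_succ_iff_deriv.1 this).2.2
  refine aux_mv (fun s => f (t + s) - f t - deriv f t * s)
    (fun s => deriv f (t + s) - deriv f t)
    (fun s => a * s ^ 2 / 2 + b * s ^ 3 / 6) (fun s => a * s + b * s ^ 2 / 2) ?_ ?_
    (by simp) (by simp) (aux_first (deriv f) hf' t a b hb) s
  · intro s
    have := ((HasDerivAt.comp_const_add t s (hd (t + s))).sub_const (f t)).sub
      ((hasDerivAt_id s).const_mul (deriv f t))
    simpa using! this
  · intro s
    have := (((hasDerivAt_pow 2 s).const_mul a).div_const 2).add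
      (((hasDerivAt_pow 3 s).const_mul b).div_const 6)
    convert! this using 1
    simp
    ring

lemma aux_int (h : SchwartzMap ℝ ℝ) (k : ℕ) : Integrable (fun s : ℝ => |h s| * |s| ^ k) := by
  have := h.integrable_pow_mul volume k
  simpa [mul_comm] using! this

lemma aux_deriv (h : SchwartzMap ℝ ℝ) (η : ℝ) :
    Integrable (fun s : ℝ => ((s * h s : ℝ) : ℂ) * Complex.exp (-(2 * π * Complex.I * η * s))) ∧
    deriv (𝓕 (fun u : ℝ => (h u : ℂ))) η =
      (-(2 * π * Complex.I)) *
        ∫ s : ℝ, ((s * h s : ℝ) : ℂ) * Complex.exp (-(2 * π * Complex.I * η * s)) := by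
  have hc : Continuous h := h.continuous
  have h0 : Integrable (fun u : ℝ => (h u : ℂ)) := (h.integrable (μ := volume)).ofReal
  have h1 : Integrable (fun u : ℝ => u • (h u : ℂ)) := by
    refine (aux_int h 1).mono' (by fun_prop) (Filter.Eventually.of_forall fun s => ?_)
    simp [mul_comm]
  constructor
  · refine (aux_int h 1).mono' (by fun_prop) (Filter.Eventually.of_forall fun s => ?_)
    rw [norm_mul, Complex.norm_exp]
    simp [mul_comm]
  · rw [Real.deriv_fourier h0 h1, Real.fourier_real_eq_integral_exp_smul, ← integral_const_mul]
    congr 1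
    ext s
    have : ((-2 * π * s * η : ℝ) : ℂ) * Complex.I = -(2 * π * Complex.I * η * s) := by
      push_cast; ring
    rw [this]
    simp only [smul_eq_mul]
    push_cast
    ring

lemma aux_main (h : SchwartzMap ℝ ℝ) (ξ b p ω : ℝ)
    (hz : deriv (𝓕 (fun u : ℝ => (h u : ℂ))) (ξ + ω) = 0) :
    (-(2 * π * Complex.I)) * ∫ s : ℝ, ((b * Real.cos (2 * π * (p + ω * s)) : ℝ) : ℂ) *
      (((s * h s : ℝ) : ℂ) * Complex.exp (-(2 * π * Complex.I * ξ * s))) =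
    (1 / 2 : ℂ) * ((b : ℂ) * Complex.exp (2 * π * Complex.I * (p : ℝ)) *
      deriv (𝓕 (fun u : ℝ => (h u : ℂ))) (ξ - ω)) := by
  obtain ⟨i1, e1⟩ := aux_deriv h (ξ - ω)
  obtain ⟨i2, e2⟩ := aux_deriv h (ξ + ω)
  have : ∀ s : ℝ, ((b * Real.cos (2 * π * (p + ω * s)) : ℝ) : ℂ) *
      (((s * h s : ℝ) : ℂ) * Complex.exp (-(2 * π * Complex.I * ξ * s))) =
      ((1 / 2 : ℂ) * b * Complex.exp (2 * π * Complex.I * p)) *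
        (((s * h s : ℝ) : ℂ) * Complex.exp (-(2 * π * Complex.I * (ξ - ω : ℝ) * s))) +
      ((1 / 2 : ℂ) * b * Complex.exp (-(2 * π * Complex.I * p))) *
        (((s * h s : ℝ) : ℂ) * Complex.exp (-(2 * π * Complex.I * (ξ + ω : ℝ) * s))) := by
    intro s
    have a1 : Complex.exp (-(2 * π * Complex.I * (ξ - ω : ℝ) * s)) =
        Complex.exp (-(2 * π * Complex.I * ξ * s)) * Complex.exp (2 * π * Complex.I * ω * s) := by
      rw [← Complex.exp_add]; congr 1; push_cast; ring
    have a2 : Complex.exp (-(2 * π * Complex.I * (ξ + ω : ℝ) * s)) =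
        Complex.exp (-(2 * π * Complex.I * ξ * s)) *
          Complex.exp (-(2 * π * Complex.I * ω * s)) := by
      rw [← Complex.exp_add]; congr 1; push_cast; ring
    have a3 : ((Real.cos (2 * π * (p + ω * s)) : ℝ) : ℂ) =
        (Complex.exp (2 * π * Complex.I * p) * Complex.exp (2 * π * Complex.I * ω * s) +
        Complex.exp (-(2 * π * Complex.I * p)) * Complex.exp (-(2 * π * Complex.I * ω * s))) / 2 := by
      rw [← Complex.exp_add, ← Complex.exp_add, Complex.ofReal_cos, Complex.cos]
      congr 2
      · congr 1; push_cast; ring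
      · congr 1; push_cast; ring
    rw [a1, a2, Complex.ofReal_mul b, a3]
    ring
  simp_rw [this]
  rw [integral_add (i1.const_mul _) (i2.const_mul _), integral_const_mul, integral_const_mul, e1]
  rw [e2] at hz
  linear_combination ((1 / 2 : ℂ) * b * Complex.exp (-(2 * π * Complex.I * p))) * hz

/-- Lemma 2, second estimate: the frequency derivative of the STFT, written as
`−i2π V_x^{(u·h)}`, is approximated by the frozen harmonic sum with `ĥ'`. -/
theorem WSFv3_STFT_freq_deriv_approx
    (B : ℕ → ℝ → ℝ) (φ : ℕ → ℝ → ℝ) (x : ℝ → ℝ)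
    (hx : ∀ t : ℝ, x t = ∑' l : ℕ, B (l + 1) t * Real.cos (2 * π * φ (l + 1) t))
    (hBC1 : ∀ l : ℕ, 1 ≤ l → ContDiff ℝ 1 (B l))
    (hBpos : ∀ l : ℕ, 1 ≤ l → ∀ t : ℝ, 0 ≤ B l t)
    (hφC2 : ∀ l : ℕ, 1 ≤ l → ContDiff ℝ 2 (φ l))
    (hφ' : ∀ l : ℕ, 1 ≤ l → ∀ t : ℝ, 0 < deriv (φ l) t)
    (ℓ : ℕ) (hℓ : 1 ≤ ℓ) (hBℓ : ∀ t : ℝ, 0 < B ℓ t)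
    (ε M : ℝ) (hε : 0 ≤ ε) (hM : 0 ≤ M)
    (c : ℕ → ℝ) (hc0 : ∀ l : ℕ, 0 ≤ c l)
    (hcs : Summable (fun l : ℕ => c (l + 1)))
    (hBc : ∀ l : ℕ, 1 ≤ l → ∀ t : ℝ, B l t ≤ c l * B ℓ t)
    (hB' : ∀ l : ℕ, 1 ≤ l → ∀ t : ℝ,
      |deriv (B l) t| ≤ ε * c l * deriv (φ ℓ) t / (ℓ : ℝ))
    (hφ'' : ∀ l : ℕ, 1 ≤ l → ∀ t : ℝ,
      |deriv (deriv (φ l)) t| ≤ ε * (l : ℝ) * deriv (φ ℓ) t / (ℓ : ℝ))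
    (hφ''M : ∀ l : ℕ, 1 ≤ l → ∀ t : ℝ, |deriv (deriv (φ l)) t| ≤ M)
    (hsum : ∀ t : ℝ, Summable (fun l : ℕ => ((l : ℝ) + 1) * B (l + 1) t))
    (h : SchwartzMap ℝ ℝ) (hne : h ≠ 0) (heven : ∀ t : ℝ, h (-t) = h t)
    (H : ℝ) (hH : 0 < H)
    (hsupp : ∀ ζ : ℝ, ζ ∉ Set.Icc (-H) H → 𝓕 (fun t : ℝ => (h t : ℂ)) ζ = 0)
    (hsep1 : ∀ t : ℝ, H < deriv (φ 1) t)
    (hsep : ∀ j : ℕ, 1 ≤ j → ∀ t : ℝ,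
      2 * H < deriv (φ (j + 1)) t - deriv (φ j) t)
    (m : ℕ → ℝ) (hm : ∀ k : ℕ, m k = ∫ t : ℝ, |h t| * |t| ^ k) :
    ∀ t₀ : ℝ, ∀ ξ : ℝ, 0 ≤ ξ →
      ‖(-(2 * π * Complex.I)) * STFT (fun u => u * h u) x t₀ ξ
          - (1 / 2 : ℂ) * ∑' l : ℕ, (B (l + 1) t₀ : ℂ) *
              Complex.exp (2 * π * Complex.I * (φ (l + 1) t₀ : ℝ)) *
              deriv (𝓕 (fun u : ℝ => (h u : ℂ))) (ξ - deriv (φ (l + 1)) t₀)‖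
        ≤ ε * (2 * π / (ℓ : ℝ) * (deriv (φ ℓ) t₀ * m 2 + M * m 3 / 2) *
              (∑' l : ℕ, c (l + 1))
            + 2 * π ^ 2 / (ℓ : ℝ) * (deriv (φ ℓ) t₀ * m 3 + M * m 4 / 3) *
                (∑' l : ℕ, ((l : ℝ) + 1) * B (l + 1) t₀)) := by
  intro t₀ ξ hξ
  have hℓ0 : (0 : ℝ) < ℓ := by exact_mod_cast hℓ
  have hc : Continuous h := h.continuous
  -- frequency gaps
  have hfreq : ∀ l : ℕ, H < deriv (φ (l + 1)) t₀ := by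
    intro l
    induction l with
    | zero => exact hsep1 t₀
    | succ n ih => have := hsep (n + 1) (by omega) t₀; linarith
  have hz : ∀ l : ℕ, deriv (𝓕 (fun u : ℝ => (h u : ℂ))) (ξ + deriv (φ (l + 1)) t₀) = 0 := by
    intro l
    have hgt : H < ξ + deriv (φ (l + 1)) t₀ := by linarith [hfreq l]
    have : (𝓕 (fun u : ℝ => (h u : ℂ))) =ᶠ[nhds (ξ + deriv (φ (l + 1)) t₀)] fun _ => (0 : ℂ) := by
      filter_upwards [lt_mem_nhds hgt] with ζ hζ
      exact hsupp ζ (fun hh => absurd hh.2 (not_le.2 hζ))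
    rw [this.deriv_eq]
    simp
  -- growth of φ_ℓ'
  set A := deriv (φ ℓ) t₀ with hA
  have hA0 : 0 < A := hφ' ℓ hℓ t₀
  have hgrow : ∀ s, deriv (φ ℓ) (t₀ + s) ≤ A + M * |s| := by
    intro s
    have hf' : ContDiff ℝ 1 (deriv (φ ℓ)) := by
      have : ContDiff ℝ (1 + 1) (φ ℓ) := by simpa [one_add_one_eq_two] using hφC2 ℓ hℓ
      exact (contDiff_succ_iff_deriv.1 this).2.2
    have := aux_first _ hf' t₀ M 0 (fun s => by simpa using hφ''M ℓ hℓ (t₀ + s)) s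
    have := (abs_le.1 this).2
    simp at this
    linarith
  have hBs : ∀ t, Summable (fun l : ℕ => B (l + 1) t) := by
    intro t
    refine (hsum t).of_nonneg_of_le (fun l => hBpos _ (by omega) t) fun l => ?_
    have := hBpos (l + 1) (by omega) t
    nlinarith [(Nat.cast_nonneg l : (0 : ℝ) ≤ l)]
  have hcosS : ∀ t (θ : ℕ → ℝ), Summable (fun l : ℕ => B (l + 1) t * Real.cos (θ l)) := by
    intro t θ
    refine (hBs t).of_norm_bounded fun l => ?_
    rw [norm_mul, Real.norm_eq_abs, Real.norm_eq_abs, abs_of_nonneg (hBpos (l + 1) (by omega) t)]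
    exact mul_le_of_le_one_right (hBpos (l + 1) (by omega) t) (Real.abs_cos_le_one _)
  set y : ℝ → ℝ := fun s => ∑' l : ℕ, B (l + 1) t₀ *
    Real.cos (2 * π * (φ (l + 1) t₀ + deriv (φ (l + 1)) t₀ * s)) with hy
  set C := ∑' l : ℕ, c (l + 1) with hC
  set S := ∑' l : ℕ, ((l : ℝ) + 1) * B (l + 1) t₀ with hS
  -- pointwise bound
  have hpt : ∀ s, |x (t₀ + s) - y s| ≤ ε / ℓ * (A * |s| + M * |s| ^ 2 / 2) * C +
      2 * π * (ε / ℓ) * (A * |s| ^ 2 / 2 + M * |s| ^ 3 / 6) * S := by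
    intro s
    have e : x (t₀ + s) - y s = ∑' l : ℕ, (B (l + 1) (t₀ + s) *
        Real.cos (2 * π * φ (l + 1) (t₀ + s)) - B (l + 1) t₀ *
        Real.cos (2 * π * (φ (l + 1) t₀ + deriv (φ (l + 1)) t₀ * s))) := by
      rw [hx, hy]
      exact ((hcosS _ _).tsum_sub (hcosS _ _)).symm
    rw [e, ← Real.norm_eq_abs]
    refine tsum_of_norm_bounded ((hcs.hasSum.mul_left _).add ((hsum t₀).hasSum.mul_left _)) ?_
    intro l
    have b1 := aux_first _ (hBC1 (l + 1) (by omega)) t₀ (ε / ℓ * c (l + 1) * A)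
      (ε / ℓ * c (l + 1) * M) (fun s => by
        refine (hB' (l + 1) (by omega) (t₀ + s)).trans ?_
        have := mul_le_mul_of_nonneg_left (hgrow s)
          (mul_nonneg (div_nonneg hε hℓ0.le) (hc0 (l + 1)))
        calc _ = ε / ℓ * c (l + 1) * deriv (φ ℓ) (t₀ + s) := by ring
          _ ≤ _ := this
          _ = _ := by ring) s
    have b2 := aux_second _ (hφC2 (l + 1) (by omega)) t₀ (ε / ℓ * (l + 1) * A)
      (ε / ℓ * (l + 1) * M) (fun s => by
        refine (hφ'' (l + 1) (by omega) (t₀ + s)).trans ?_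
        have := mul_le_mul_of_nonneg_left (hgrow s)
          (mul_nonneg (div_nonneg hε hℓ0.le) (by positivity : (0 : ℝ) ≤ (l : ℝ) + 1))
        calc _ = ε / ℓ * (l + 1) * deriv (φ ℓ) (t₀ + s) := by push_cast; ring
          _ ≤ _ := this
          _ = _ := by ring) s
    have b3 : |Real.cos (2 * π * φ (l + 1) (t₀ + s)) -
        Real.cos (2 * π * (φ (l + 1) t₀ + deriv (φ (l + 1)) t₀ * s))| ≤
        2 * π * (ε / ℓ * (l + 1) * A * |s| ^ 2 / 2 + ε / ℓ * (l + 1) * M * |s| ^ 3 / 6) := by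
      refine (Real.abs_cos_sub_cos_le _ _).trans ?_
      rw [show 2 * π * φ (l + 1) (t₀ + s) - 2 * π * (φ (l + 1) t₀ + deriv (φ (l + 1)) t₀ * s) =
        2 * π * (φ (l + 1) (t₀ + s) - φ (l + 1) t₀ - deriv (φ (l + 1)) t₀ * s) by ring,
        abs_mul, abs_of_pos Real.two_pi_pos]
      gcongr
    have hb0 := hBpos (l + 1) (by omega) t₀
    rw [Real.norm_eq_abs]
    calc _ = |(B (l + 1) (t₀ + s) - B (l + 1) t₀) * Real.cos (2 * π * φ (l + 1) (t₀ + s)) +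
          B (l + 1) t₀ * (Real.cos (2 * π * φ (l + 1) (t₀ + s)) -
        Real.cos (2 * π * (φ (l + 1) t₀ + deriv (φ (l + 1)) t₀ * s)))| := by congr 1; ring
      _ ≤ |B (l + 1) (t₀ + s) - B (l + 1) t₀| * 1 +
          B (l + 1) t₀ * |Real.cos (2 * π * φ (l + 1) (t₀ + s)) -
        Real.cos (2 * π * (φ (l + 1) t₀ + deriv (φ (l + 1)) t₀ * s))| := by
          refine (abs_add_le _ _).trans ?_
          rw [abs_mul, abs_mul, abs_of_nonneg hb0]
          gcongr
          exact Real.abs_cos_le_one _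
      _ ≤ _ * 1 + _ := add_le_add (mul_le_mul_of_nonneg_right b1 zero_le_one)
          (mul_le_mul_of_nonneg_left b3 hb0)
      _ = _ := by ring
  -- kernel
  set K : ℝ → ℂ := fun s => ((s * h s : ℝ) : ℂ) * Complex.exp (-(2 * π * Complex.I * ξ * s))
    with hK
  have hKc : Continuous K := by rw [hK]; fun_prop
  have hKn : ∀ s, ‖K s‖ = |h s| * |s| := by
    intro s
    rw [hK]
    simp only [norm_mul, Complex.norm_exp]
    simp [mul_comm]
  have hKi : Integrable K := (aux_deriv h ξ).1
  have hST : STFT (fun u => u * h u) x t₀ ξ = ∫ s, (x (t₀ + s) : ℂ) * K s := by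
    unfold STFT
    rw [← integral_add_right_eq_self _ t₀]
    congr 1
    ext s
    simp only [hK]
    push_cast
    rw [add_comm s]
    simp only [add_sub_cancel_left]
    ring
  -- measurability
  have hxm : Measurable x := by
    refine measurable_of_tendsto_metrizable
      (f := fun n t => ∑ l ∈ Finset.range n, B (l + 1) t * Real.cos (2 * π * φ (l + 1) t))
      (fun n => ?_) ?_
    · refine Finset.measurable_sum _ fun l _ => ?_
      have h1 := (hBC1 (l + 1) (by omega)).continuous
      have h2 := (hφC2 (l + 1) (by omega)).continuous
      fun_prop
    · rw [tendsto_pi_nhds]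
      intro t
      rw [hx]
      exact (hcosS t _).hasSum.tendsto_sum_nat
  have hym : Measurable y := by
    refine measurable_of_tendsto_metrizable
      (f := fun n s => ∑ l ∈ Finset.range n, B (l + 1) t₀ *
        Real.cos (2 * π * (φ (l + 1) t₀ + deriv (φ (l + 1)) t₀ * s)))
      (fun n => ?_) ?_
    · refine Finset.measurable_sum _ fun l _ => ?_
      fun_prop
    · rw [tendsto_pi_nhds]
      intro t
      exact (hcosS t₀ _).hasSum.tendsto_sum_nat
  -- main sum
  set G : ℕ → ℝ → ℂ := fun l s => ((B (l + 1) t₀ *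
    Real.cos (2 * π * (φ (l + 1) t₀ + deriv (φ (l + 1)) t₀ * s)) : ℝ) : ℂ) * K s with hG
  have hGn : ∀ l s, ‖G l s‖ ≤ B (l + 1) t₀ * ‖K s‖ := by
    intro l s
    have hb0 := hBpos (l + 1) (by omega) t₀
    simp only [hG]
    rw [norm_mul, Complex.norm_real, norm_mul, Real.norm_eq_abs, Real.norm_eq_abs,
      abs_of_nonneg hb0]
    gcongr
    exact mul_le_of_le_one_right hb0 (Real.abs_cos_le_one _)
  have hGi : ∀ l, Integrable (G l) := by
    intro l
    refine (hKi.norm.const_mul (B (l + 1) t₀)).mono' ?_ (Filter.Eventually.of_forall (hGn l))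
    apply Continuous.aestronglyMeasurable
    rw [hG]
    fun_prop
  have hGsum : Summable fun l => ∫ s, ‖G l s‖ := by
    refine ((hBs t₀).mul_right (∫ s, ‖K s‖)).of_nonneg_of_le
      (fun l => integral_nonneg fun s => norm_nonneg _) fun l => ?_
    rw [← integral_const_mul]
    exact integral_mono (hGi l).norm (hKi.norm.const_mul _) (hGn l)
  have hGt : ∀ s, ∑' l, G l s = (y s : ℂ) * K s := by
    intro s
    simp only [hG, hy]
    rw [tsum_mul_right, Complex.ofReal_tsum]
  have hGS := hasSum_integral_of_summable_integral_norm hGi hGsum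
  simp_rw [hGt] at hGS
  have hmain : (1 / 2 : ℂ) * ∑' l : ℕ, (B (l + 1) t₀ : ℂ) *
              Complex.exp (2 * π * Complex.I * (φ (l + 1) t₀ : ℝ)) *
              deriv (𝓕 (fun u : ℝ => (h u : ℂ))) (ξ - deriv (φ (l + 1)) t₀) =
      (-(2 * π * Complex.I)) * ∫ s, (y s : ℂ) * K s := by
    rw [← hGS.tsum_eq, ← tsum_mul_left, ← tsum_mul_left]
    congr 1
    ext l
    exact (aux_main h ξ _ _ _ (hz l)).symm
  have hyb : ∀ s, |y s| ≤ ∑' l : ℕ, B (l + 1) t₀ := by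
    intro s
    rw [← Real.norm_eq_abs]
    refine tsum_of_norm_bounded (hBs t₀).hasSum fun l => ?_
    have hb0 := hBpos (l + 1) (by omega) t₀
    rw [norm_mul, Real.norm_eq_abs, Real.norm_eq_abs, abs_of_nonneg hb0]
    exact mul_le_of_le_one_right hb0 (Real.abs_cos_le_one _)
  have hyi : Integrable fun s => (y s : ℂ) * K s := by
    refine (hKi.norm.const_mul (∑' l : ℕ, B (l + 1) t₀)).mono' ?_
      (Filter.Eventually.of_forall fun s => ?_)
    · exact (Complex.measurable_ofReal.comp hym).aestronglyMeasurable.mul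
        hKc.aestronglyMeasurable
    · rw [norm_mul, Complex.norm_real, Real.norm_eq_abs]
      gcongr
      exact hyb s
  -- dominating function
  set E : ℝ → ℝ := fun s => ε / ℓ * C * A * (|h s| * |s| ^ 2) +
    (ε / ℓ * C * M / 2) * (|h s| * |s| ^ 3) +
    (π * (ε / ℓ) * S * A * (|h s| * |s| ^ 3) +
    π * (ε / ℓ) * S * M / 3 * (|h s| * |s| ^ 4)) with hE
  have hE1 := (aux_int h 2).const_mul (ε / ℓ * C * A)
  have hE2 := (aux_int h 3).const_mul (ε / ℓ * C * M / 2)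
  have hE3 := (aux_int h 3).const_mul (π * (ε / ℓ) * S * A)
  have hE4 := (aux_int h 4).const_mul (π * (ε / ℓ) * S * M / 3)
  have hEi : Integrable E := (hE1.add hE2).add (hE3.add hE4)
  have hEv : ∫ s, E s = ε / ℓ * C * A * m 2 + (ε / ℓ * C * M / 2) * m 3 +
      (π * (ε / ℓ) * S * A * m 3 + π * (ε / ℓ) * S * M / 3 * m 4) := by
    have e0 := integral_add' (hE1.add hE2) (hE3.add hE4)
    rw [integral_add' hE1 hE2, integral_add' hE3 hE4] at e0
    simp only [integral_const_mul, ← hm] at e0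
    exact e0
  have hdb : ∀ s, ‖((x (t₀ + s) - y s : ℝ) : ℂ) * K s‖ ≤ E s := by
    intro s
    rw [norm_mul, Complex.norm_real, Real.norm_eq_abs, hKn]
    refine (mul_le_mul_of_nonneg_right (hpt s) (by positivity)).trans (le_of_eq ?_)
    simp only [hE]
    ring
  have hdi : Integrable fun s => ((x (t₀ + s) - y s : ℝ) : ℂ) * K s := by
    refine hEi.mono' ?_ (Filter.Eventually.of_forall hdb)
    refine (Complex.measurable_ofReal.comp ?_).aestronglyMeasurable.mul hKc.aestronglyMeasurable
    exact (hxm.comp (measurable_const_add t₀)).sub hym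
  have hsplit : ∫ s, (x (t₀ + s) : ℂ) * K s =
      (∫ s, ((x (t₀ + s) - y s : ℝ) : ℂ) * K s) + ∫ s, (y s : ℂ) * K s := by
    rw [← integral_add hdi hyi]
    congr 1
    ext s
    push_cast
    ring
  rw [hmain, hST, hsplit, mul_add, add_sub_cancel_right, norm_mul]
  have hn : ‖(-(2 * π * Complex.I) : ℂ)‖ = 2 * π := by
    simp [abs_of_pos Real.pi_pos]
  rw [hn]
  have hfin := norm_integral_le_of_norm_le hEi (Filter.Eventually.of_forall hdb)
  rw [hEv] at hfin
  refine (mul_le_mul_of_nonneg_left hfin Real.two_pi_pos.le).trans (le_of_eq ?_)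
  ring
end

section
/- Under the WSFv3 model with no change points, for every t₀ ∈ ℝ and every ξ ≥ 0, the STFT with the differentiated window h' satisfies: | V_x^{(h')}(t₀, ξ) − iπ Σ_{l≥1} B_l(t₀) e^{i2πφ_l(t₀)} (ξ − φ_l'(t₀)) ĥ(ξ − φ_l'(t₀)) | ≤ ε·[ (1/ℓ)( φ_ℓ'(t₀) m₁' + M m₂'/2 ) Σ_{l≥1} c(l) + (π/ℓ)( φ_ℓ'(t₀) m₂' + M m₃'/3 ) Σ_{l≥1} l·B_l(t₀) ]. -/
open Real MeasureTheory
open scoped FourierTransform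

lemma aux_int_nonneg (f : ℝ → ℝ) (hf : Differentiable ℝ f) (a b : ℝ) (h0 : f 0 = 0)
    (hd : ∀ s, |deriv f s| ≤ a * |s| + b * s ^ 2) (s : ℝ) (hs : 0 ≤ s) :
    |f s| ≤ a * s ^ 2 / 2 + b * |s| ^ 3 / 3 := by
  rw [abs_of_nonneg hs]
  have := image_norm_le_of_norm_deriv_right_le_deriv_boundary (f := f) (f' := deriv f)
    (a := 0) (b := s) (B := fun s => a * s ^ 2 / 2 + b * s ^ 3 / 3)
    (B' := fun s => a * s + b * s ^ 2) hf.continuous.continuousOn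
    (fun x _ => (hf x).hasDerivAt.hasDerivWithinAt) (by simp [h0])
    (fun x => by
      have h2 := ((hasDerivAt_pow 2 x).const_mul a).div_const 2
      have h3 := ((hasDerivAt_pow 3 x).const_mul b).div_const 3
      exact (h2.add h3).congr_deriv (by push_cast; ring))
    (fun x hx => by
      have := hd x
      rwa [abs_of_nonneg hx.1] at this)
    (Set.right_mem_Icc.2 hs)
  simpa using this

lemma aux_int_s7 (f : ℝ → ℝ) (hf : Differentiable ℝ f) (a b : ℝ) (h0 : f 0 = 0)
    (hd : ∀ s, |deriv f s| ≤ a * |s| + b * s ^ 2) (s : ℝ) :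
    |f s| ≤ a * s ^ 2 / 2 + b * |s| ^ 3 / 3 := by
  rcases le_total 0 s with hs | hs
  · exact aux_int_nonneg f hf a b h0 hd s hs
  · have := aux_int_nonneg (fun s => f (-s)) (hf.comp differentiable_neg) a b (by simpa using h0)
      (fun s => by
        rw [deriv_comp_neg, abs_neg]
        simpa using hd (-s)) (-s) (by linarith)
    simpa using this

lemma aux_dom (f g : ℝ → ℝ) (hf : Differentiable ℝ f) (hg : Differentiable ℝ g) (K : ℝ)
    (hd : ∀ s, |deriv f s| ≤ K * deriv g s) (s t : ℝ) :
    |f s - f t| ≤ |K * (g s - g t)| := by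
  have m1 : Monotone (fun s => K * g s - f s) := by
    apply monotone_of_deriv_nonneg ((hg.const_mul K).sub hf)
    intro x
    have := ((hg x).hasDerivAt.const_mul K).sub (hf x).hasDerivAt
    have e := this.deriv
    have hh := abs_le.1 (hd x)
    calc (0:ℝ) ≤ K * deriv g x - deriv f x := by linarith
      _ = _ := e.symm
  have m2 : Monotone (fun s => K * g s + f s) := by
    apply monotone_of_deriv_nonneg ((hg.const_mul K).add hf)
    intro x
    have := ((hg x).hasDerivAt.const_mul K).add (hf x).hasDerivAt
    have e := this.deriv
    have hh := abs_le.1 (hd x)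
    calc (0:ℝ) ≤ K * deriv g x + deriv f x := by linarith
      _ = _ := e.symm
  rcases le_total s t with hst | hst
  · have h1 := m1 hst
    have h2 := m2 hst
    simp only at h1 h2
    rw [abs_sub_comm (f s), ← abs_neg (K * _)]
    refine le_trans (abs_le.2 ⟨?_, ?_⟩) (le_abs_self _) <;> linarith
  · have h1 := m1 hst
    have h2 := m2 hst
    simp only at h1 h2
    refine le_trans (abs_le.2 ⟨?_, ?_⟩) (le_abs_self _) <;> linarith

/-- growth of the dominant phase -/
lemma aux_phase (g : ℝ → ℝ) (hg : ContDiff ℝ 2 g) (M : ℝ)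
    (h2 : ∀ t, |deriv (deriv g) t| ≤ M) (t s : ℝ) :
    |g (t + s) - g t - deriv g t * s| ≤ M * s ^ 2 / 2 := by
  have hd : Differentiable ℝ g := hg.differentiable (by norm_num)
  have hd' : Differentiable ℝ (deriv g) := by
    have : ContDiff ℝ 1 (deriv g) := hg.deriv'
    exact this.differentiable (by norm_num)
  have hder : ∀ s, HasDerivAt (fun s => g (t + s) - g t - deriv g t * s)
      (deriv g (t + s) - deriv g t) s := by
    intro s
    have h1 := (((hd (t + s)).hasDerivAt.comp_const_add t s).sub_const (g t)).sub
      ((hasDerivAt_id s).const_mul (deriv g t))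
    exact h1.congr_deriv (by simp)
  have := aux_int_s7 (fun s => g (t + s) - g t - deriv g t * s)
    (fun s => (hder s).differentiableAt) M 0 (by simp) (fun s => by
      rw [(hder s).deriv]
      have := Convex.norm_image_sub_le_of_norm_deriv_le (f := deriv g) (s := Set.univ)
        (x := t) (y := t + s) (C := M) (fun x _ => hd' x) (fun x _ => h2 x) convex_univ
        trivial trivial
      simpa using this) s
  simpa using this

lemma aux_growth (g : ℝ → ℝ) (hg : ContDiff ℝ 2 g) (M : ℝ) (hp : ∀ t, 0 < deriv g t)
    (h2 : ∀ t, |deriv (deriv g) t| ≤ M) (t s : ℝ) :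
    |g (t + s) - g t| ≤ deriv g t * |s| + M * s ^ 2 / 2 := by
  have h := aux_phase g hg M h2 t s
  have e : g (t + s) - g t = (g (t + s) - g t - deriv g t * s) + deriv g t * s := by ring
  rw [e]
  refine (abs_add_le _ _).trans ?_
  rw [abs_mul, abs_of_pos (hp t)]
  linarith

lemma aux_phase2 (f g : ℝ → ℝ) (hf : ContDiff ℝ 2 f) (hg : ContDiff ℝ 2 g) (K M : ℝ)
    (hK : 0 ≤ K) (hp : ∀ t, 0 < deriv g t)
    (h1 : ∀ t, |deriv (deriv f) t| ≤ K * deriv g t)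
    (h2 : ∀ t, |deriv (deriv g) t| ≤ M) (t s : ℝ) :
    |f (t + s) - f t - deriv f t * s| ≤ K * (deriv g t * s ^ 2 / 2 + M * |s| ^ 3 / 6) := by
  have hd : Differentiable ℝ f := hf.differentiable (by norm_num)
  have hdg : Differentiable ℝ g := hg.differentiable (by norm_num)
  have hd' : Differentiable ℝ (deriv f) := by
    have : ContDiff ℝ 1 (deriv f) := hf.deriv'
    exact this.differentiable (by norm_num)
  have hder : ∀ s, HasDerivAt (fun s => f (t + s) - f t - deriv f t * s)
      (deriv f (t + s) - deriv f t) s := by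
    intro s
    have h1 := (((hd (t + s)).hasDerivAt.comp_const_add t s).sub_const (f t)).sub
      ((hasDerivAt_id s).const_mul (deriv f t))
    exact h1.congr_deriv (by simp)
  have := aux_int_s7 (fun s => f (t + s) - f t - deriv f t * s)
    (fun s => (hder s).differentiableAt) (K * deriv g t) (K * M / 2) (by simp) (fun s => by
      rw [(hder s).deriv]
      refine (aux_dom (deriv f) g hd' hdg K h1 _ _).trans ?_
      rw [abs_mul, abs_of_nonneg hK]
      have := mul_le_mul_of_nonneg_left (aux_growth g hg M hp h2 t s) hK
      linarith) s
  refine this.trans (le_of_eq ?_)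
  ring

lemma aux_term (b b0 p q P K1 K2 : ℝ) (hb0 : 0 ≤ b0) (h1 : |b - b0| ≤ K1)
    (h2 : |P - p - q| ≤ K2) :
    |b * cos (2 * π * P) - b0 * cos (2 * π * (p + q))| ≤ K1 + 2 * π * b0 * K2 := by
  have e : b * cos (2 * π * P) - b0 * cos (2 * π * (p + q))
      = (b - b0) * cos (2 * π * P) + b0 * (cos (2 * π * P) - cos (2 * π * (p + q))) := by ring
  rw [e]
  refine (abs_add_le _ _).trans (add_le_add ?_ ?_)
  · rw [abs_mul]
    have := mul_le_mul_of_nonneg_left (abs_cos_le_one (2 * π * P)) (abs_nonneg (b - b0))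
    linarith
  · rw [abs_mul, abs_of_nonneg hb0]
    have h3 := abs_cos_sub_cos_le (2 * π * P) (2 * π * (p + q))
    have e2 : 2 * π * P - 2 * π * (p + q) = (2 * π) * (P - p - q) := by ring
    rw [e2, abs_mul, abs_of_pos two_pi_pos] at h3
    have h4 := mul_le_mul_of_nonneg_left h2 two_pi_pos.le
    have h5 := mul_le_mul_of_nonneg_left (h3.trans h4) hb0
    linarith

lemma aux_mom (h : SchwartzMap ℝ ℝ) (k : ℕ) :
    Integrable (fun t : ℝ => |deriv (⇑h) t| * |t| ^ k) := by
  have := SchwartzMap.integrable_pow_mul volume (SchwartzMap.derivCLM ℝ ℝ h) k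
  simpa [SchwartzMap.derivCLM_apply, mul_comm] using this

lemma aux_dint (h : SchwartzMap ℝ ℝ) : Integrable (deriv (⇑h)) :=
  (SchwartzMap.derivCLM ℝ ℝ h).integrable

lemma aux_dcont (h : SchwartzMap ℝ ℝ) : Continuous (deriv (⇑h)) :=
  (SchwartzMap.derivCLM ℝ ℝ h).continuous

lemma aux_fourier (h : SchwartzMap ℝ ℝ) (w : ℝ) :
    ∫ v : ℝ, ((deriv (⇑h) v : ℝ) : ℂ) * Complex.exp (-(2 * π * Complex.I * w * v))
      = 2 * π * Complex.I * w * 𝓕 (fun u : ℝ => (h u : ℂ)) w := by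
  have hder : ∀ v, HasDerivAt (fun u : ℝ => (h u : ℂ)) ((deriv (⇑h) v : ℝ) : ℂ) v := fun v =>
    (h.differentiableAt (x := v)).hasDerivAt.ofReal_comp
  have hde : deriv (fun u : ℝ => (h u : ℂ)) = fun v => ((deriv (⇑h) v : ℝ) : ℂ) :=
    funext fun v => (hder v).deriv
  have := congrFun (Real.fourier_deriv (f := fun u : ℝ => (h u : ℂ)) h.integrable.ofReal
    (fun v => (hder v).differentiableAt) (by rw [hde]; exact (aux_dint h).ofReal)) w
  rw [hde, fourier_real_eq_integral_exp_smul] at this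
  rw [smul_eq_mul] at this
  rw [← this]
  congr 1
  ext v
  rw [smul_eq_mul, mul_comm]
  congr 2
  push_cast
  ring

lemma aux_eint (h : SchwartzMap ℝ ℝ) (w : ℝ) :
    Integrable (fun v : ℝ => ((deriv (⇑h) v : ℝ) : ℂ) *
      Complex.exp (-(2 * π * Complex.I * w * v))) := by
  refine (aux_dint h).norm.mono' ?_ (Filter.Eventually.of_forall fun v => ?_)
  · have := aux_dcont h
    exact Continuous.aestronglyMeasurable (by fun_prop)
  · have e : -(2 * π * Complex.I * w * v) = ((-(2 * π * w * v) : ℝ) : ℂ) * Complex.I := by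
      push_cast; ring
    rw [norm_mul, e, Complex.norm_exp_ofReal_mul_I]
    simp

/-- the frozen harmonic -/
lemma aux_frozen (h : SchwartzMap ℝ ℝ) (b p q ξ : ℝ)
    (hz : 𝓕 (fun u : ℝ => (h u : ℂ)) (ξ + q) = 0) :
    ∫ s : ℝ, ((b * cos (2 * π * (p + q * s)) * deriv (⇑h) s : ℝ) : ℂ) *
        Complex.exp (-(2 * π * Complex.I * ξ * s))
      = Complex.I * π * ((b : ℂ) * Complex.exp (2 * π * Complex.I * (p : ℝ)) *
        ((ξ - q : ℝ) : ℂ) * 𝓕 (fun u : ℝ => (h u : ℂ)) (ξ - q)) := by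
  have e : ∀ s : ℝ, ((b * cos (2 * π * (p + q * s)) * deriv (⇑h) s : ℝ) : ℂ) *
        Complex.exp (-(2 * π * Complex.I * ξ * s))
      = (b / 2 * Complex.exp (2 * π * Complex.I * (p : ℝ))) * (((deriv (⇑h) s : ℝ) : ℂ) *
          Complex.exp (-(2 * π * Complex.I * ((ξ - q : ℝ) : ℂ) * s)))
        + (b / 2 * Complex.exp (-(2 * π * Complex.I * (p : ℝ)))) * (((deriv (⇑h) s : ℝ) : ℂ) *
          Complex.exp (-(2 * π * Complex.I * ((ξ + q : ℝ) : ℂ) * s))) := by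
    intro s
    push_cast
    rw [Complex.cos]
    have e1 : Complex.exp (2 * π * (p + q * s) * Complex.I) =
        Complex.exp (2 * π * Complex.I * p) * Complex.exp (2 * π * Complex.I * q * s) := by
      rw [← Complex.exp_add]; congr 1; ring
    have e2 : Complex.exp (-(2 * π * (p + q * s)) * Complex.I) =
        Complex.exp (-(2 * π * Complex.I * p)) * Complex.exp (-(2 * π * Complex.I * q * s)) := by
      rw [← Complex.exp_add]; congr 1; ring
    have e3 : Complex.exp (-(2 * π * Complex.I * (ξ - q) * s)) =
        Complex.exp (2 * π * Complex.I * q * s) * Complex.exp (-(2 * π * Complex.I * ξ * s)) := by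
      rw [← Complex.exp_add]; congr 1; ring
    have e4 : Complex.exp (-(2 * π * Complex.I * (ξ + q) * s)) =
        Complex.exp (-(2 * π * Complex.I * q * s)) *
          Complex.exp (-(2 * π * Complex.I * ξ * s)) := by
      rw [← Complex.exp_add]; congr 1; ring
    rw [e1, e2, e3, e4]
    ring
  simp_rw [e]
  rw [integral_add ((aux_eint h _).const_mul _) ((aux_eint h _).const_mul _),
    integral_const_mul, integral_const_mul, aux_fourier, aux_fourier, hz]
  ring

/-- Lemma 2, third estimate: STFT with the differentiated window `h'` is approximated
by the frozen harmonic sum `iπ Σ B_l e^{i2πφ_l}(ξ − φ_l')ĥ(ξ − φ_l')`. -/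
theorem WSFv3_STFT_diff_window_approx
    (B : ℕ → ℝ → ℝ) (φ : ℕ → ℝ → ℝ) (x : ℝ → ℝ)
    (hx : ∀ t : ℝ, x t = ∑' l : ℕ, B (l + 1) t * Real.cos (2 * π * φ (l + 1) t))
    (hBC1 : ∀ l : ℕ, 1 ≤ l → ContDiff ℝ 1 (B l))
    (hBpos : ∀ l : ℕ, 1 ≤ l → ∀ t : ℝ, 0 ≤ B l t)
    (hφC2 : ∀ l : ℕ, 1 ≤ l → ContDiff ℝ 2 (φ l))
    (hφ' : ∀ l : ℕ, 1 ≤ l → ∀ t : ℝ, 0 < deriv (φ l) t)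
    (ℓ : ℕ) (hℓ : 1 ≤ ℓ) (hBℓ : ∀ t : ℝ, 0 < B ℓ t)
    (ε M : ℝ) (hε : 0 ≤ ε) (hM : 0 ≤ M)
    (c : ℕ → ℝ) (hc0 : ∀ l : ℕ, 0 ≤ c l)
    (hcs : Summable (fun l : ℕ => c (l + 1)))
    (hBc : ∀ l : ℕ, 1 ≤ l → ∀ t : ℝ, B l t ≤ c l * B ℓ t)
    (hB' : ∀ l : ℕ, 1 ≤ l → ∀ t : ℝ,
      |deriv (B l) t| ≤ ε * c l * deriv (φ ℓ) t / (ℓ : ℝ))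
    (hφ'' : ∀ l : ℕ, 1 ≤ l → ∀ t : ℝ,
      |deriv (deriv (φ l)) t| ≤ ε * (l : ℝ) * deriv (φ ℓ) t / (ℓ : ℝ))
    (hφ''M : ∀ l : ℕ, 1 ≤ l → ∀ t : ℝ, |deriv (deriv (φ l)) t| ≤ M)
    (hsum : ∀ t : ℝ, Summable (fun l : ℕ => ((l : ℝ) + 1) * B (l + 1) t))
    (h : SchwartzMap ℝ ℝ) (hne : h ≠ 0) (heven : ∀ t : ℝ, h (-t) = h t)
    (H : ℝ) (hH : 0 < H)
    (hsupp : ∀ ζ : ℝ, ζ ∉ Set.Icc (-H) H → 𝓕 (fun t : ℝ => (h t : ℂ)) ζ = 0)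
    (hsep1 : ∀ t : ℝ, H < deriv (φ 1) t)
    (hsep : ∀ j : ℕ, 1 ≤ j → ∀ t : ℝ,
      2 * H < deriv (φ (j + 1)) t - deriv (φ j) t)
    (m' : ℕ → ℝ) (hm' : ∀ k : ℕ, m' k = ∫ t : ℝ, |deriv (⇑h) t| * |t| ^ k) :
    ∀ t₀ : ℝ, ∀ ξ : ℝ, 0 ≤ ξ →
      ‖STFT (fun u => deriv (⇑h) u) x t₀ ξ
          - Complex.I * π * ∑' l : ℕ, (B (l + 1) t₀ : ℂ) *
              Complex.exp (2 * π * Complex.I * (φ (l + 1) t₀ : ℝ)) *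
              ((ξ - deriv (φ (l + 1)) t₀ : ℝ) : ℂ) *
              𝓕 (fun u : ℝ => (h u : ℂ)) (ξ - deriv (φ (l + 1)) t₀)‖
        ≤ ε * (1 / (ℓ : ℝ) * (deriv (φ ℓ) t₀ * m' 1 + M * m' 2 / 2) *
              (∑' l : ℕ, c (l + 1))
            + π / (ℓ : ℝ) * (deriv (φ ℓ) t₀ * m' 2 + M * m' 3 / 3) *
                (∑' l : ℕ, ((l : ℝ) + 1) * B (l + 1) t₀)) := by
  intro t₀ ξ hξ
  have hℓ0 : (0:ℝ) < ℓ := by exact_mod_cast hℓ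
  set K : ℝ := ε / ℓ with hK
  have hK0 : 0 ≤ K := div_nonneg hε hℓ0.le
  set a : ℝ := deriv (φ ℓ) t₀ with ha
  have ha0 : 0 < a := hφ' ℓ hℓ t₀
  have hφℓd : Differentiable ℝ (φ ℓ) := (hφC2 ℓ hℓ).differentiable (by norm_num)
  -- amplitude bound
  have hBb : ∀ l : ℕ, 1 ≤ l → ∀ s, |B l (t₀ + s) - B l t₀| ≤
      K * c l * (a * |s| + M * s ^ 2 / 2) := by
    intro l hl s
    have hKc : 0 ≤ K * c l := mul_nonneg hK0 (hc0 l)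
    refine (aux_dom (B l) (φ ℓ) ((hBC1 l hl).differentiable (by norm_num)) hφℓd (K * c l)
      (fun s => (hB' l hl s).trans (le_of_eq (by rw [hK]; ring))) _ _).trans ?_
    rw [abs_mul, abs_of_nonneg hKc]
    exact mul_le_mul_of_nonneg_left
      (aux_growth (φ ℓ) (hφC2 ℓ hℓ) M (hφ' ℓ hℓ) (hφ''M ℓ hℓ) t₀ s) hKc
  -- phase bound
  have hφb : ∀ l : ℕ, 1 ≤ l → ∀ s, |φ l (t₀ + s) - φ l t₀ - deriv (φ l) t₀ * s| ≤
      K * l * (a * s ^ 2 / 2 + M * |s| ^ 3 / 6) := by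
    intro l hl s
    exact aux_phase2 (φ l) (φ ℓ) (hφC2 l hl) (hφC2 ℓ hℓ) (K * l) M (by positivity) (hφ' ℓ hℓ)
      (fun s => (hφ'' l hl s).trans (le_of_eq (by rw [hK]; ring))) (hφ''M ℓ hℓ) t₀ s
  -- instantaneous frequencies exceed H
  have hfreq : ∀ l : ℕ, H < deriv (φ (l + 1)) t₀ := by
    intro l
    induction l with
    | zero => simpa using hsep1 t₀
    | succ n ih => have := hsep (n + 1) (by omega) t₀; linarith
  have hsumB : Summable (fun l : ℕ => B (l + 1) t₀) := by
    refine Summable.of_nonneg_of_le (fun l => hBpos _ (by omega) _) (fun l => ?_) (hsum t₀)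
    have := hBpos (l + 1) (by omega) t₀
    have h2 : (0:ℝ) ≤ l := Nat.cast_nonneg l
    nlinarith
  set e : ℝ → ℂ := fun s => Complex.exp (-(2 * π * Complex.I * ξ * s)) with he
  have hen : ∀ s, ‖e s‖ = 1 := by
    intro s
    have e1 : -(2 * π * Complex.I * ξ * s) = ((-(2 * π * ξ * s) : ℝ) : ℂ) * Complex.I := by
      push_cast; ring
    rw [he]
    simp only
    rw [e1, Complex.norm_exp_ofReal_mul_I]
  have hec : Continuous e := by rw [he]; fun_prop
  have hdc := aux_dcont h
  set F : ℕ → ℝ → ℂ := fun l s =>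
    ((B (l + 1) (t₀ + s) * cos (2 * π * φ (l + 1) (t₀ + s)) * deriv (⇑h) s : ℝ) : ℂ) * e s with hF
  set G : ℕ → ℝ → ℂ := fun l s =>
    ((B (l + 1) t₀ * cos (2 * π * (φ (l + 1) t₀ + deriv (φ (l + 1)) t₀ * s)) *
      deriv (⇑h) s : ℝ) : ℂ) * e s with hG
  have hFc : ∀ l, Continuous (F l) := by
    intro l
    have h1 := (hBC1 (l + 1) (by omega)).continuous
    have h2 := (hφC2 (l + 1) (by omega)).continuous
    rw [hF]; fun_prop
  have hGc : ∀ l, Continuous (G l) := by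
    intro l
    rw [hG]; fun_prop
  -- bound on F - G
  have hFG : ∀ l s, ‖F l s - G l s‖ ≤
      K * c (l + 1) * (a * (|deriv (⇑h) s| * |s| ^ 1) + M / 2 * (|deriv (⇑h) s| * |s| ^ 2)) +
      π * K * ((l + 1) * B (l + 1) t₀) *
        (a * (|deriv (⇑h) s| * |s| ^ 2) + M / 3 * (|deriv (⇑h) s| * |s| ^ 3)) := by
    intro l s
    have e1 : F l s - G l s = ((( B (l + 1) (t₀ + s) * cos (2 * π * φ (l + 1) (t₀ + s)) -
        B (l + 1) t₀ * cos (2 * π * (φ (l + 1) t₀ + deriv (φ (l + 1)) t₀ * s))) *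
          deriv (⇑h) s : ℝ) : ℂ) * e s := by
      simp only [hF, hG]; push_cast; ring
    rw [e1, norm_mul, hen, mul_one, Complex.norm_real, norm_mul, Real.norm_eq_abs,
      Real.norm_eq_abs]
    have h1 := aux_term _ _ _ _ _ _ _ (hBpos (l + 1) (by omega) t₀) (hBb (l + 1) (by omega) s)
      (hφb (l + 1) (by omega) s)
    refine (mul_le_mul_of_nonneg_right h1 (abs_nonneg (deriv (⇑h) s))).trans (le_of_eq ?_)
    rw [← sq_abs s]
    push_cast
    ring
  have hbG : ∀ l s, ‖G l s‖ ≤ B (l + 1) t₀ * (|deriv (⇑h) s| * |s| ^ 0) := by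
    intro l s
    simp only [hG]
    rw [norm_mul, hen, mul_one, Complex.norm_real, norm_mul, norm_mul, Real.norm_eq_abs,
      Real.norm_eq_abs, Real.norm_eq_abs, abs_of_nonneg (hBpos (l + 1) (by omega) t₀), pow_zero,
      mul_one]
    have := mul_le_mul_of_nonneg_left (abs_cos_le_one
      (2 * π * (φ (l + 1) t₀ + deriv (φ (l + 1)) t₀ * s))) (hBpos (l + 1) (by omega) t₀)
    exact mul_le_mul_of_nonneg_right (by linarith) (abs_nonneg _)
  have hI := aux_mom h
  have hdomI : ∀ l : ℕ, Integrable (fun s : ℝ =>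
      K * c (l + 1) * (a * (|deriv (⇑h) s| * |s| ^ 1) + M / 2 * (|deriv (⇑h) s| * |s| ^ 2)) +
      π * K * ((l + 1) * B (l + 1) t₀) *
        (a * (|deriv (⇑h) s| * |s| ^ 2) + M / 3 * (|deriv (⇑h) s| * |s| ^ 3))) := fun l =>
    ((((hI 1).const_mul a).add ((hI 2).const_mul (M / 2))).const_mul _).add
      ((((hI 2).const_mul a).add ((hI 3).const_mul (M / 3))).const_mul _)
  set E : ℕ → ℝ := fun l => K * c (l + 1) * (a * m' 1 + M / 2 * m' 2) +
      π * K * ((l + 1) * B (l + 1) t₀) * (a * m' 2 + M / 3 * m' 3) with hE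
  have hdomE : ∀ l : ℕ, ∫ s : ℝ,
      (K * c (l + 1) * (a * (|deriv (⇑h) s| * |s| ^ 1) + M / 2 * (|deriv (⇑h) s| * |s| ^ 2)) +
      π * K * ((l + 1) * B (l + 1) t₀) *
        (a * (|deriv (⇑h) s| * |s| ^ 2) + M / 3 * (|deriv (⇑h) s| * |s| ^ 3))) = E l := by
    intro l
    have i1 : Integrable (fun s : ℝ => K * c (l + 1) *
        (a * (|deriv (⇑h) s| * |s| ^ 1) + M / 2 * (|deriv (⇑h) s| * |s| ^ 2))) :=
      (((hI 1).const_mul a).add ((hI 2).const_mul (M / 2))).const_mul _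
    have i2 : Integrable (fun s : ℝ => π * K * ((l + 1) * B (l + 1) t₀) *
        (a * (|deriv (⇑h) s| * |s| ^ 2) + M / 3 * (|deriv (⇑h) s| * |s| ^ 3))) :=
      (((hI 2).const_mul a).add ((hI 3).const_mul (M / 3))).const_mul _
    rw [integral_add i1 i2,
      integral_const_mul, integral_const_mul,
      integral_add ((hI 1).const_mul a) ((hI 2).const_mul (M / 2)),
      integral_add ((hI 2).const_mul a) ((hI 3).const_mul (M / 3)),
      integral_const_mul, integral_const_mul, integral_const_mul, integral_const_mul,
      ← hm', ← hm', ← hm']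
  have hGI : ∀ l, Integrable (G l) := fun l =>
    ((hI 0).const_mul _).mono' (hGc l).aestronglyMeasurable (Filter.Eventually.of_forall (hbG l))
  have hDI : ∀ l, Integrable (fun s => F l s - G l s) := fun l =>
    (hdomI l).mono' ((hFc l).sub (hGc l)).aestronglyMeasurable
      (Filter.Eventually.of_forall (hFG l))
  have hFI : ∀ l, Integrable (F l) := fun l => by
    have := (hDI l).add (hGI l)
    refine this.congr (Filter.Eventually.of_forall fun s => ?_)
    simp
  have hEsum : HasSum E (K * (∑' l : ℕ, c (l + 1)) * (a * m' 1 + M / 2 * m' 2) +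
      π * K * (∑' l : ℕ, ((l : ℝ) + 1) * B (l + 1) t₀) * (a * m' 2 + M / 3 * m' 3)) :=
    ((hcs.hasSum.mul_left K).mul_right _).add (((hsum t₀).hasSum.mul_left (π * K)).mul_right _)
  have hFnorm : Summable (fun l => ∫ s, ‖F l s‖) := by
    refine Summable.of_nonneg_of_le (fun l => integral_nonneg fun s => norm_nonneg _)
      (fun l => ?_) (hEsum.summable.add (hsumB.mul_right (m' 0)))
    rw [← hdomE, hm' 0, ← integral_const_mul, ← integral_add (hdomI l) ((hI 0).const_mul _)]
    refine integral_mono (hFI l).norm ((hdomI l).add ((hI 0).const_mul _)) fun s => ?_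
    have e1 : F l s = (F l s - G l s) + G l s := by ring
    calc ‖F l s‖ = ‖(F l s - G l s) + G l s‖ := by rw [← e1]
      _ ≤ _ := (norm_add_le _ _).trans (add_le_add (hFG l s) (hbG l s))
  have hmain := hasSum_integral_of_summable_integral_norm hFI hFnorm
  have hST : STFT (fun u => deriv (⇑h) u) x t₀ ξ = ∫ s, ∑' l, F l s := by
    rw [STFT, ← integral_add_left_eq_self _ t₀]
    congr 1
    ext s
    simp only [hF]
    rw [tsum_mul_right, hx, add_sub_cancel_left, ← tsum_mul_right, Complex.ofReal_tsum]
    congr 2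
    push_cast
    ring
  have hDle : ∀ l, ‖(∫ s, F l s) - ∫ s, G l s‖ ≤ E l := by
    intro l
    rw [← integral_sub (hFI l) (hGI l), ← hdomE]
    exact norm_integral_le_of_norm_le (hdomI l) (Filter.Eventually.of_forall (hFG l))
  have hDsum : Summable (fun l => (∫ s, F l s) - ∫ s, G l s) :=
    Summable.of_norm_bounded hEsum.summable hDle
  have hGval : ∀ l, ∫ s, G l s = Complex.I * π * ((B (l + 1) t₀ : ℂ) *
              Complex.exp (2 * π * Complex.I * (φ (l + 1) t₀ : ℝ)) *
              ((ξ - deriv (φ (l + 1)) t₀ : ℝ) : ℂ) *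
              𝓕 (fun u : ℝ => (h u : ℂ)) (ξ - deriv (φ (l + 1)) t₀)) := by
    intro l
    refine aux_frozen h _ _ _ ξ (hsupp _ fun hm => ?_)
    have := hfreq l
    linarith [hm.2]
  have hfin : STFT (fun u => deriv (⇑h) u) x t₀ ξ
          - Complex.I * π * ∑' l : ℕ, (B (l + 1) t₀ : ℂ) *
              Complex.exp (2 * π * Complex.I * (φ (l + 1) t₀ : ℝ)) *
              ((ξ - deriv (φ (l + 1)) t₀ : ℝ) : ℂ) *
              𝓕 (fun u : ℝ => (h u : ℂ)) (ξ - deriv (φ (l + 1)) t₀)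
      = ∑' l, ((∫ s, F l s) - ∫ s, G l s) := by
    have hGs : Summable (fun l => ∫ s, G l s) := by
      have := hmain.summable.sub hDsum
      refine this.congr fun l => ?_
      ring
    rw [hmain.summable.tsum_sub hGs, hmain.tsum_eq, hST, ← tsum_mul_left]
    congr 1
    exact tsum_congr fun l => (hGval l).symm
  rw [hfin]
  refine (tsum_of_norm_bounded hEsum hDle).trans (le_of_eq ?_)
  rw [hK]
  ring
end
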